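/- arXiv:1901.01817 — 6 statements merged into one kernel-verified Lean document; each statement's English description precedes it below -/
import Mathlib

section
/- Let G and H be loop-free finite connected directed graphs, each with at least two vertices. Then there exists a graph homomorphism φ: G → H (a vertex map sending every edge of G to an edge of H) if and only if there exists a homomorphism ψ: G† → H† of the associated two-unary-operation algebras (a function commuting with both unary operations f and g). -/
/-- The two-unary-operation encoding `G†` of a directed graph `(V, E)`:
elements `v₁, v₂` for each vertex `v`, and `a_e, b_e` for each edge `e`. -/
inductive Dag (V : Type) (E : V → V → Prop) : Type where
  | v1 : V → Dag V E
  | v2 : V → Dag V E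
  | a : {p : V × V // E p.1 p.2} → Dag V E
  | b : {p : V × V // E p.1 p.2} → Dag V E

/-- The first unary operation `f` of `G†`. -/
def Dag.fop {V : Type} {E : V → V → Prop} : Dag V E → Dag V E
  | .v1 v => .v1 v
  | .v2 v => .v1 v
  | .a e => .v1 e.val.1
  | .b e => .v2 e.val.2

/-- The second unary operation `g` of `G†`. -/
def Dag.gop {V : Type} {E : V → V → Prop} : Dag V E → Dag V E
  | .v1 v => .v2 v
  | .v2 v => .v2 v
  | .a e => .b e
  | .b e => .a e

/-- For loop-free finite connected directed graphs `G`, `H` with at least two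
vertices, there is a graph homomorphism `G → H` iff there is a homomorphism
of the associated two-unary-operation algebras `G† → H†`. -/
theorem stmt0 {V W : Type} [Fintype V] [Fintype W]
    (E : V → V → Prop) (F : W → W → Prop)
    (hEloop : ∀ v, ¬ E v v) (hFloop : ∀ w, ¬ F w w)
    (hEconn : ∀ u v : V, Relation.ReflTransGen (fun x y => E x y ∨ E y x) u v)
    (hFconn : ∀ u v : W, Relation.ReflTransGen (fun x y => F x y ∨ F y x) u v)
    (hV : 2 ≤ Fintype.card V) (hW : 2 ≤ Fintype.card W) :
    (∃ φ : V → W, ∀ u v, E u v → F (φ u) (φ v)) ↔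
      (∃ ψ : Dag V E → Dag W F,
        (∀ x, ψ x.fop = (ψ x).fop) ∧ (∀ x, ψ x.gop = (ψ x).gop)) := by
  constructor
  · rintro ⟨φ, hφ⟩
    refine ⟨fun x => match x with
      | .v1 v => .v1 (φ v)
      | .v2 v => .v2 (φ v)
      | .a e => .a ⟨(φ e.val.1, φ e.val.2), hφ _ _ e.property⟩
      | .b e => .b ⟨(φ e.val.1, φ e.val.2), hφ _ _ e.property⟩, ?_, ?_⟩ <;>
    · intro x
      cases x <;> rfl
  · rintro ⟨ψ, hf, hg⟩
    have exists_v1 : ∀ v, ∃ w, ψ (.v1 v) = .v1 w := by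
      intro v
      have h := hf (.v1 v)
      simp only [Dag.fop] at h
      generalize ψ (.v1 v) = y at h
      cases y <;> simp_all [Dag.fop]
    choose φ hφ using exists_v1
    have hφ₂ : ∀ v, ψ (.v2 v) = .v2 (φ v) := by
      intro v
      simpa [hφ, Dag.gop] using hg (.v1 v)
    refine ⟨φ, fun u v huv => ?_⟩
    have hfa := hf (.a ⟨(u, v), huv⟩)
    have hga := hg (.a ⟨(u, v), huv⟩)
    have hfb := hf (.b ⟨(u, v), huv⟩)
    have hgb := hg (.b ⟨(u, v), huv⟩)
    simp only [Dag.fop, Dag.gop, hφ, hφ₂] at hfa hga hfb hgb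
    rw [hga] at hfb hgb
    generalize ψ (.a ⟨(u, v), huv⟩) = y at hfa hfb hgb
    cases y with
    | v1 w => simp at hgb
    | v2 w => simp at hfb
    | a e =>
      simp only [Dag.v1.injEq, Dag.v2.injEq] at hfa hfb
      rw [hfa, hfb]
      exact e.property
    | b e => simp at hfa
end

section
/- Let G and H be loop-free finite connected directed graphs, each with at least two vertices. Then there exist graph homomorphisms φ₁: G → H and φ₂: H → G with φ₁ ∘ φ₂ = id_H if and only if there exist algebra homomorphisms ψ₁: G† → H† and ψ₂: H† → G† with ψ₁ ∘ ψ₂ = id_{H†}. (The paper phrases the left-hand condition as 'G is isomorphic to a subgraph of H' and the right-hand condition as 'G† is a retraction of H†'.) -/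
namespace Dag

variable {V W : Type} {E : V → V → Prop} {F : W → W → Prop}

/-- The map `G† → H†` induced by a graph homomorphism `φ : G → H`. -/
def map (φ : V → W) (hφ : ∀ u v, E u v → F (φ u) (φ v)) : Dag V E → Dag W F
  | .v1 v => .v1 (φ v)
  | .v2 v => .v2 (φ v)
  | .a e => .a ⟨(φ e.val.1, φ e.val.2), hφ _ _ e.property⟩
  | .b e => .b ⟨(φ e.val.1, φ e.val.2), hφ _ _ e.property⟩

theorem map_fop (φ : V → W) (hφ : ∀ u v, E u v → F (φ u) (φ v)) (x : Dag V E) :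
    map φ hφ x.fop = (map φ hφ x).fop := by
  cases x <;> rfl

theorem map_gop (φ : V → W) (hφ : ∀ u v, E u v → F (φ u) (φ v)) (x : Dag V E) :
    map φ hφ x.gop = (map φ hφ x).gop := by
  cases x <;> rfl

theorem map_comp_map_eq_id {φ₁ : V → W} {φ₂ : W → V}
    (h₁ : ∀ u v, E u v → F (φ₁ u) (φ₁ v)) (h₂ : ∀ u v, F u v → E (φ₂ u) (φ₂ v))
    (h : φ₁ ∘ φ₂ = id) : map φ₁ h₁ ∘ map φ₂ h₂ = id := by
  have h' : ∀ w, φ₁ (φ₂ w) = w := congrFun h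
  funext x
  cases x <;> simp [map, h']

/-- The fixed points of `f` are exactly the elements `v₁`. -/
theorem exists_eq_v1_of_fop_eq_self {x : Dag V E} (hx : x.fop = x) : ∃ v, x = v1 v := by
  cases x <;> simp_all [fop]

/-- Every homomorphism `G† → H†` is given on the elements `v₁` by a graph homomorphism. -/
theorem exists_graph_hom {ψ : Dag V E → Dag W F}
    (hf : ∀ x, ψ x.fop = (ψ x).fop) (hg : ∀ x, ψ x.gop = (ψ x).gop) :
    ∃ φ : V → W, (∀ v, ψ (v1 v) = v1 (φ v)) ∧ ∀ u v, E u v → F (φ u) (φ v) := by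
  have h₁ : ∀ v, ∃ w, ψ (v1 v) = v1 w := fun v =>
    exists_eq_v1_of_fop_eq_self (hf (v1 v)).symm
  choose φ hφ using h₁
  refine ⟨φ, hφ, fun u v huv => ?_⟩
  have hv : ψ (v2 v) = v2 (φ v) := by
    have := hg (v1 v)
    rwa [hφ] at this
  have hs : v1 (φ u) = (ψ (a ⟨(u, v), huv⟩)).fop := (hφ u).symm.trans (hf (a ⟨(u, v), huv⟩))
  have ht : v2 (φ v) = (ψ (a ⟨(u, v), huv⟩)).gop.fop := by
    rw [← hg, ← hf]
    exact hv.symm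
  cases hx : ψ (a ⟨(u, v), huv⟩) with
  | a e =>
    rw [hx] at hs ht
    simp only [fop, gop, v1.injEq, v2.injEq] at hs ht
    rw [hs, ht]
    exact e.property
  | _ =>
    rw [hx] at hs ht
    simp [fop, gop] at hs ht

end Dag

/-- For loop-free finite connected directed graphs `G`, `H` with at least two
vertices, there are graph homomorphisms `φ₁ : G → H`, `φ₂ : H → G` with
`φ₁ ∘ φ₂ = id_H` iff there are algebra homomorphisms `ψ₁ : G† → H†`,
`ψ₂ : H† → G†` with `ψ₁ ∘ ψ₂ = id_{H†}`. -/
theorem stmt1 {V W : Type} [Fintype V] [Fintype W]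
    (E : V → V → Prop) (F : W → W → Prop)
    (hEloop : ∀ v, ¬ E v v) (hFloop : ∀ w, ¬ F w w)
    (hEconn : ∀ u v : V, Relation.ReflTransGen (fun x y => E x y ∨ E y x) u v)
    (hFconn : ∀ u v : W, Relation.ReflTransGen (fun x y => F x y ∨ F y x) u v)
    (hV : 2 ≤ Fintype.card V) (hW : 2 ≤ Fintype.card W) :
    (∃ (φ₁ : V → W) (φ₂ : W → V),
        (∀ u v, E u v → F (φ₁ u) (φ₁ v)) ∧
        (∀ u v, F u v → E (φ₂ u) (φ₂ v)) ∧
        φ₁ ∘ φ₂ = id) ↔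
      (∃ (ψ₁ : Dag V E → Dag W F) (ψ₂ : Dag W F → Dag V E),
        ((∀ x, ψ₁ x.fop = (ψ₁ x).fop) ∧ (∀ x, ψ₁ x.gop = (ψ₁ x).gop)) ∧
        ((∀ x, ψ₂ x.fop = (ψ₂ x).fop) ∧ (∀ x, ψ₂ x.gop = (ψ₂ x).gop)) ∧
        ψ₁ ∘ ψ₂ = id) := by
  constructor
  · rintro ⟨φ₁, φ₂, h₁, h₂, h⟩
    exact ⟨Dag.map φ₁ h₁, Dag.map φ₂ h₂, ⟨Dag.map_fop φ₁ h₁, Dag.map_gop φ₁ h₁⟩,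
      ⟨Dag.map_fop φ₂ h₂, Dag.map_gop φ₂ h₂⟩, Dag.map_comp_map_eq_id h₁ h₂ h⟩
  · rintro ⟨ψ₁, ψ₂, ⟨hf₁, hg₁⟩, ⟨hf₂, hg₂⟩, h⟩
    obtain ⟨φ₁, hφ₁, h₁⟩ := Dag.exists_graph_hom hf₁ hg₁
    obtain ⟨φ₂, hφ₂, h₂⟩ := Dag.exists_graph_hom hf₂ hg₂
    refine ⟨φ₁, φ₂, h₁, h₂, funext fun w => ?_⟩
    have hw := congrFun h (Dag.v1 w)
    simpa [hφ₁, hφ₂] using hw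
end

section
/- Let G and H be finite undirected loopless graphs, each with at least two vertices. Then every magma homomorphism ψ: G* → H* fixes the four distinguished elements, i.e., ψ(a) = a, ψ(b) = b, ψ(c) = c, ψ(d) = d; and for every vertex v ∈ V_G there exists a vertex u ∈ V_H such that ψ(v₁) = u₁ and ψ(v₂) = u₂. -/
/-- The universe of the magma `G*`: two elements `v₁, v₂` for each vertex `v`,
plus four distinguished elements `a, b, c, d`. -/
inductive StarAlg (V : Type) : Type where
  | v1 : V → StarAlg V
  | v2 : V → StarAlg V
  | a : StarAlg V
  | b : StarAlg V
  | c : StarAlg V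
  | d : StarAlg V

open Classical in
/-- The binary operation of the magma `G*` associated to an undirected
loopless graph `G`. -/
noncomputable def starMul {V : Type} (G : SimpleGraph V) : StarAlg V → StarAlg V → StarAlg V
  | .v1 u, .v1 v => if u = v then .d else if G.Adj u v then .a else .d
  | .v2 u, .v2 v => if u = v then .d else .b
  | .v1 u, .v2 v => if u = v then .c else .d
  | .v2 u, .v1 v => if u = v then .c else .d
  | .v1 u, _ => .v1 u
  | .v2 u, _ => .v2 u
  | _, .v1 v => .v1 v
  | _, .v2 v => .v2 v
  | .a, .a => .b
  | .b, .b => .c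
  | .c, .c => .d
  | _, _ => .a

section Homomorphisms

variable {V W : Type} {G : SimpleGraph V} {H : SimpleGraph W} {ψ : StarAlg V → StarAlg W}

/-- A homomorphism `G* → H*` fixes the four distinguished elements. -/
theorem starMul_hom_fixes (hψ : ∀ x y, ψ (starMul G x y) = starMul H (ψ x) (ψ y)) :
    ψ .a = .a ∧ ψ .b = .b ∧ ψ .c = .c ∧ ψ .d = .d := by
  have hb : ψ .b = _ := hψ .a .a
  have hc : ψ .c = _ := hψ .b .b
  have hd : ψ .d = _ := hψ .c .c
  have ha : ψ .a = _ := hψ .d .d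
  have hab : ψ .a = _ := hψ .a .b
  rw [hd, hc, hb] at ha
  rw [hb] at hab hc
  rw [hc] at hd
  rw [hc, hd, hb]
  cases h : ψ .a <;> simp [h, starMul] at ha hab ⊢

/-- A product in `G*` with left factor `u₁` is never `b`. -/
theorem starMul_v1_ne_b (u : V) (x : StarAlg V) : starMul G (.v1 u) x ≠ .b := by
  cases x <;> grind [starMul]

/-- An element `x` with `x · x = d` and `a · x = x` is one of the `u₁`, `u₂`. -/
theorem exists_eq_v1_or_v2 {x : StarAlg V} (hsq : starMul G x x = .d)
    (habs : starMul G .a x = x) : ∃ u, x = .v1 u ∨ x = .v2 u := by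
  cases x <;> simp [starMul] at hsq habs ⊢

/-- A homomorphism `G* → H*` sends each element `x` with `x · x = d` and `a · x = x` (in
particular each `v₁` and `v₂`) to some `u₁` or `u₂`. -/
theorem starMul_hom_vertex (hψ : ∀ x y, ψ (starMul G x y) = starMul H (ψ x) (ψ y))
    {x : StarAlg V} (hsq : starMul G x x = .d) (habs : starMul G .a x = x) :
    ∃ u, ψ x = .v1 u ∨ ψ x = .v2 u := by
  obtain ⟨ha, -, -, hd⟩ := starMul_hom_fixes hψ
  refine exists_eq_v1_or_v2 (G := H) ?_ ?_
  · rw [← hψ, hsq, hd]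
  · have h := hψ .a x
    rwa [habs, ha, eq_comm] at h

/-- If `v` is not the only vertex of `G`, a homomorphism `G* → H*` sends `v₁, v₂` to `u₁, u₂` for
a single vertex `u`. -/
theorem starMul_hom_pair (hψ : ∀ x y, ψ (starMul G x y) = starMul H (ψ x) (ψ y))
    {v w : V} (hvw : v ≠ w) : ∃ u : W, ψ (.v1 v) = .v1 u ∧ ψ (.v2 v) = .v2 u := by
  obtain ⟨-, hb, hc, -⟩ := starMul_hom_fixes hψ
  have h12 := hψ (.v1 v) (.v2 v)
  have h22 := hψ (.v2 v) (.v2 w)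
  simp only [starMul, if_true, if_neg hvw, hb, hc] at h12 h22
  obtain ⟨u, hu | hu⟩ := starMul_hom_vertex hψ (x := .v2 v) (by simp [starMul]) rfl
  · rw [hu] at h22
    exact absurd h22.symm (starMul_v1_ne_b u _)
  obtain ⟨t, ht | ht⟩ := starMul_hom_vertex hψ (x := .v1 v) (by simp [starMul]) rfl
  · rw [hu, ht] at h12
    by_cases htu : t = u
    · exact ⟨u, htu ▸ ht, hu⟩
    · simp [htu] at h12
  · rw [hu, ht] at h12
    simp only at h12
    split_ifs at h12

end Homomorphisms

/-- For finite undirected loopless graphs `G`, `H` with at least two vertices,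
every magma homomorphism `ψ : G* → H*` fixes the four distinguished elements,
and sends each pair `v₁, v₂` to a pair `u₁, u₂` for a single vertex `u` of `H`. -/
theorem stmt3 {V W : Type} [Fintype V] [Fintype W]
    (G : SimpleGraph V) (H : SimpleGraph W)
    (hV : 2 ≤ Fintype.card V) (hW : 2 ≤ Fintype.card W) :
    ∀ ψ : StarAlg V → StarAlg W,
      (∀ x y, ψ (starMul G x y) = starMul H (ψ x) (ψ y)) →
      (ψ .a = .a ∧ ψ .b = .b ∧ ψ .c = .c ∧ ψ .d = .d) ∧
      (∀ v : V, ∃ u : W, ψ (.v1 v) = .v1 u ∧ ψ (.v2 v) = .v2 u) := by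
  intro ψ hψ
  refine ⟨starMul_hom_fixes hψ, fun v => ?_⟩
  have : Nontrivial V := Fintype.one_lt_card_iff_nontrivial.mp hV
  obtain ⟨w, hw⟩ := exists_ne v
  exact starMul_hom_pair hψ hw.symm
end

section
/- Let G and H be finite undirected loopless graphs, let X_G and Y_H be their semigroup encodings, and let f: X_G → Z and h: Y_H → Z be the standard surjective homomorphisms. Then there exists a semigroup homomorphism g: X_G → Y_H with f = h ∘ g if and only if there exists a graph homomorphism φ: G → H (a vertex map sending every edge of G to an edge of H). -/
/-- The universe of the semigroup encoding `X_G` of an undirected loopless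
graph `G`: an element for each vertex, an element `χ_s` for each non-edge
pair `s` (including diagonal pairs), and distinguished elements
`b`, `b²`, `c`, `0`. -/
inductive SGE (V : Type) (G : SimpleGraph V) : Type where
  | vert : V → SGE V G
  | chi : (s : Sym2 V) → s ∉ G.edgeSet → SGE V G
  | b : SGE V G
  | bsq : SGE V G
  | c : SGE V G
  | zero : SGE V G

open Classical in
/-- The multiplication of the semigroup `X_G`. -/
noncomputable def sgeMul {V : Type} (G : SimpleGraph V) : SGE V G → SGE V G → SGE V G
  | .b, .b => .bsq
  | .b, .vert _ => .c
  | .vert _, .b => .c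
  | .vert u, .vert v =>
      if h : G.Adj u v then .c
      else .chi s(u, v) (fun hmem => h ((SimpleGraph.mem_edgeSet G).mp hmem))
  | _, _ => .zero

/-- The 5-element semigroup `Z = {0, a, b, b², c}`. -/
inductive Zsg : Type where
  | zero : Zsg
  | a : Zsg
  | b : Zsg
  | bsq : Zsg
  | c : Zsg

/-- The multiplication of `Z`: `a·a = a·b = b·a = c`, `b·b = b²`,
all other products `0`. -/
def zsgMul : Zsg → Zsg → Zsg
  | .a, .a => .c
  | .a, .b => .c
  | .b, .a => .c
  | .b, .b => .bsq
  | _, _ => .zero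

/-- The standard surjective homomorphism `X_G → Z`. -/
def stdHom {V : Type} (G : SimpleGraph V) : SGE V G → Zsg
  | .vert _ => .a
  | .chi _ _ => .c
  | .b => .b
  | .bsq => .bsq
  | .c => .c
  | .zero => .zero

open Classical in
/-- The map `X_G → Y_H` of semigroup encodings induced by a vertex map `φ`. -/
noncomputable def sgeMap {V W : Type} (G : SimpleGraph V) (H : SimpleGraph W) (φ : V → W) :
    SGE V G → SGE W H
  | .vert v => .vert (φ v)
  | .chi s _ => if h : s.map φ ∈ H.edgeSet then .c else .chi (s.map φ) h
  | .b => .b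
  | .bsq => .bsq
  | .c => .c
  | .zero => .zero

theorem stdHom_sgeMap {V W : Type} (G : SimpleGraph V) (H : SimpleGraph W) (φ : V → W)
    (x : SGE V G) : stdHom H (sgeMap G H φ x) = stdHom G x := by
  cases x <;> simp only [sgeMap, stdHom]
  split_ifs <;> rfl

theorem sgeMap_mul {V W : Type} (G : SimpleGraph V) (H : SimpleGraph W) (φ : V → W)
    (hφ : ∀ u v, G.Adj u v → H.Adj (φ u) (φ v)) (x y : SGE V G) :
    sgeMap G H φ (sgeMul G x y) = sgeMul H (sgeMap G H φ x) (sgeMap G H φ y) := by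
  cases x <;> cases y <;> simp only [sgeMul, sgeMap]
  case vert.vert u v =>
    by_cases h : G.Adj u v
    · simp [h, hφ u v h]
    · by_cases h' : H.Adj (φ u) (φ v) <;> simp [h, h']
  all_goals split_ifs <;> rfl

theorem eq_b_of_stdHom {V : Type} {G : SimpleGraph V} {x : SGE V G}
    (hx : stdHom G x = .b) : x = .b := by
  cases x <;> simp_all [stdHom]

theorem exists_eq_vert_of_stdHom {V : Type} {G : SimpleGraph V} {x : SGE V G}
    (hx : stdHom G x = .a) : ∃ v, x = .vert v := by
  cases x <;> simp_all [stdHom]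

/-- For finite undirected loopless graphs `G`, `H` with semigroup encodings
`X_G`, `Y_H` and standard surjective homomorphisms `f : X_G → Z`,
`h : Y_H → Z`, there is a semigroup homomorphism `g : X_G → Y_H` with
`f = h ∘ g` iff there is a graph homomorphism `G → H`. -/
theorem stmt4 {V W : Type} [Fintype V] [Fintype W]
    (G : SimpleGraph V) (H : SimpleGraph W) :
    (∃ g : SGE V G → SGE W H,
        (∀ x y, g (sgeMul G x y) = sgeMul H (g x) (g y)) ∧
        (∀ x, stdHom H (g x) = stdHom G x)) ↔
      (∃ φ : V → W, ∀ u v, G.Adj u v → H.Adj (φ u) (φ v)) := by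
  constructor
  · rintro ⟨g, hmul, hstd⟩
    have hb : g .b = .b := eq_b_of_stdHom (hstd .b)
    choose φ hφ using fun v => exists_eq_vert_of_stdHom (hstd (.vert v))
    refine ⟨φ, fun u v huv => ?_⟩
    have hc : g .c = .c := by simpa [sgeMul, hb, hφ] using hmul .b (.vert u)
    by_contra h
    simpa [sgeMul, hφ, huv, h, hc] using hmul (.vert u) (.vert v)
  · rintro ⟨φ, hφ⟩
    exact ⟨sgeMap G H φ, sgeMap_mul G H φ hφ, stdHom_sgeMap G H φ⟩
end

section
/- For every natural number n there exist a finite semigroup X with |X| ≥ n and a surjective semigroup homomorphism f: X → Z, where Z is the 5-element semigroup described below, such that the identity map is the only semigroup homomorphism r: X → X satisfying r ∘ r = r and f ∘ r = f. (Consequently, the variety of semigroups does not have bounded f-cores.) -/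
/-- The semigroup encoding of the complete graph on `V`: the vertices, a marker element `b` with
its square, the two values `edge` and `loop` of products of vertices, and `0`. -/
inductive CompleteGraphSg (V : Type) : Type where
  | vertex (v : V)
  | zero
  | b
  | bsq
  | edge
  | loop

namespace CompleteGraphSg

variable {V : Type}

open Classical in
noncomputable instance [Fintype V] : Fintype (CompleteGraphSg V) where
  elems := {zero, b, bsq, edge, loop} ∪ Finset.univ.image vertex
  complete x := by cases x <;> simp

/-- The product of two vertices is `loop` if they agree and `edge` otherwise; the product of a
vertex and `b` is `edge`. -/
def mul [DecidableEq V] : CompleteGraphSg V → CompleteGraphSg V → CompleteGraphSg V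
  | vertex v, vertex w => if v = w then loop else edge
  | vertex _, b => edge
  | b, vertex _ => edge
  | b, b => bsq
  | _, _ => zero

/-- The homomorphism to `Z` sending vertices to `a`, and edges and loops to `c`. -/
def toZsg : CompleteGraphSg V → Zsg
  | vertex _ => .a
  | zero => .zero
  | b => .b
  | bsq => .bsq
  | edge => .c
  | loop => .c

theorem mul_assoc [DecidableEq V] (x y z : CompleteGraphSg V) :
    mul (mul x y) z = mul x (mul y z) := by
  cases x <;> cases y <;> cases z <;> grind [mul]

theorem toZsg_mul [DecidableEq V] (x y : CompleteGraphSg V) :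
    toZsg (mul x y) = zsgMul (toZsg x) (toZsg y) := by
  cases x <;> cases y <;> simp only [mul, toZsg, zsgMul]
  split_ifs <;> rfl

theorem toZsg_surjective [Nonempty V] :
    Function.Surjective (toZsg : CompleteGraphSg V → Zsg)
  | .zero => ⟨zero, rfl⟩
  | .a => ⟨vertex (Classical.arbitrary V), rfl⟩
  | .b => ⟨b, rfl⟩
  | .bsq => ⟨bsq, rfl⟩
  | .c => ⟨edge, rfl⟩

theorem eq_self_of_retraction [DecidableEq V] [Nonempty V]
    {r : CompleteGraphSg V → CompleteGraphSg V}
    (hmul : ∀ x y, r (mul x y) = mul (r x) (r y)) (hidem : ∀ x, r (r x) = r x)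
    (hf : ∀ x, toZsg (r x) = toZsg x) (x : CompleteGraphSg V) : r x = x := by
  have hb : r b = b := by
    have h := hf b
    cases hr : r b <;> simp_all [toZsg]
  have hvertex (v : V) : ∃ w, r (vertex v) = vertex w := by
    have h := hf (vertex v)
    cases hr : r (vertex v) <;> simp_all [toZsg]
  let u : V := Classical.arbitrary V
  have hedge : r edge = edge := by
    obtain ⟨w, hw⟩ := hvertex u
    simpa [mul, hw, hb] using hmul (vertex u) b
  have hfix (v : V) : r (vertex v) = vertex v := by
    obtain ⟨w, hw⟩ := hvertex v
    have hww : r (vertex w) = vertex w := by simpa [hw] using hidem (vertex v)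
    by_contra hne
    have hvw : v ≠ w := fun h => hne (h ▸ hww)
    simpa [mul, hw, hww, hvw, hedge] using hmul (vertex v) (vertex w)
  have hloop : r loop = loop := by
    simpa [mul, hfix] using hmul (vertex u) (vertex u)
  have h := hf x
  cases x with
  | vertex v => exact hfix v
  | b => exact hb
  | edge => exact hedge
  | loop => exact hloop
  | zero => cases hr : r zero <;> simp_all [toZsg]
  | bsq => cases hr : r bsq <;> simp_all [toZsg]

theorem card_le [Fintype V] : Fintype.card V ≤ Fintype.card (CompleteGraphSg V) :=
  Fintype.card_le_of_injective vertex fun _ _ h => by cases h; rfl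

end CompleteGraphSg

/-- For every natural number `n` there is a finite semigroup `X` with
`|X| ≥ n` and a surjective semigroup homomorphism `f : X → Z` such that the
identity is the only homomorphism `r : X → X` with `r ∘ r = r` and
`f ∘ r = f`; i.e. `X` is an `f`-core.  (So semigroups do not have bounded
`f`-cores.) -/
theorem stmt8 :
    ∀ n : ℕ, ∃ (X : Type) (_ : Fintype X) (mul : X → X → X),
      (∀ x y z : X, mul (mul x y) z = mul x (mul y z)) ∧
      n ≤ Fintype.card X ∧
      ∃ f : X → Zsg, Function.Surjective f ∧
        (∀ x y, f (mul x y) = zsgMul (f x) (f y)) ∧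
        ∀ r : X → X,
          (∀ x y, r (mul x y) = mul (r x) (r y)) →
          (∀ x, r (r x) = r x) →
          (∀ x, f (r x) = f x) →
          ∀ x, r x = x := by
  intro n
  refine ⟨CompleteGraphSg (Fin (n + 3)), inferInstance, CompleteGraphSg.mul,
    CompleteGraphSg.mul_assoc, ?_, CompleteGraphSg.toZsg, CompleteGraphSg.toZsg_surjective,
    CompleteGraphSg.toZsg_mul, fun _ => CompleteGraphSg.eq_self_of_retraction⟩
  calc n ≤ Fintype.card (Fin (n + 3)) := by simp
    _ ≤ _ := CompleteGraphSg.card_le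
end

section
/- For every natural number n there exist a finite meet-semilattice X with |X| > n and a surjective meet-semilattice homomorphism f: X → Z, where Z is the 4-element meet-semilattice described below, such that the identity map is the only meet-semilattice homomorphism e: X → X satisfying e ∘ e = e and f ∘ e = f. (Consequently, the variety of semilattices does not have bounded f-cores.) -/
/-- The 4-element meet-semilattice `Z = {0, a, b, c}` in which `0` is least
and `a`, `b`, `c` are pairwise incomparable atoms. -/
inductive Z4 : Type where
  | zero : Z4
  | a : Z4
  | b : Z4
  | c : Z4
  deriving DecidableEq

/-- The meet operation of `Z4`: `x ∧ x = x` and the meet of any two distinct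
elements is `0`. -/
def z4meet : Z4 → Z4 → Z4 := fun x y => if x = y then x else .zero

/-- Points of the set representation: zigzag points `link r i` and separating points `sep r`. -/
inductive ZigzagPoint (N : ℕ) : Type where
  | link : Fin 3 → Fin (N + 1) → ZigzagPoint N
  | sep : Fin 3 → ZigzagPoint N

namespace ZigzagPoint

variable {N : ℕ}

instance : Finite (ZigzagPoint N) :=
  Finite.of_surjective
    (fun x : (Fin 3 × Fin (N + 1)) ⊕ Fin 3 => x.elim (fun p => link p.1 p.2) sep) (by
      rintro (⟨r, i⟩ | r)
      · exact ⟨.inl (r, i), rfl⟩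
      · exact ⟨.inr r, rfl⟩)

/-- The level of a point with respect to the chain `s`. -/
def level (s : Fin 3) : ZigzagPoint N → ℕ
  | link r i => if s = r then i + 1 else i
  | sep r => if s = r then 0 else N + 1

/-- The `i`-th member of the `r`-th chain of generating sets. -/
def gen (N : ℕ) (r : Fin 3) (i : ℕ) : Set (ZigzagPoint N) := {p | level r p ≤ i}

/-- The sets obtained from the generating sets by binary intersections. -/
inductive Generated : Set (ZigzagPoint N) → Prop
  | basic (r : Fin 3) (i : ℕ) (hi : i ≤ N) : Generated (gen N r i)
  | inter {S T : Set (ZigzagPoint N)} : Generated S → Generated T → Generated (S ∩ T)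

theorem gen_mono (r : Fin 3) {i j : ℕ} (h : i ≤ j) : gen N r i ⊆ gen N r j :=
  fun _ hp => le_trans hp h

theorem sep_mem_gen {r s : Fin 3} {i : ℕ} (hi : i ≤ N) : sep s ∈ gen N r i ↔ r = s := by
  simp only [gen, level, Set.mem_ofPred_eq]
  split_ifs with h
  · simp [h]
  · simp only [h, iff_false]
    omega

theorem Generated.eq_gen {S : Set (ZigzagPoint N)} (hS : Generated S) {r : Fin 3}
    (hr : sep r ∈ S) : ∃ i ≤ N, S = gen N r i := by
  induction hS with
  | basic s i hi =>
    obtain rfl := (sep_mem_gen hi).1 hr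
    exact ⟨i, hi, rfl⟩
  | inter _ _ ihS ihT =>
    obtain ⟨i, hi, rfl⟩ := ihS hr.1
    obtain ⟨j, _, rfl⟩ := ihT hr.2
    refine ⟨min i j, (min_le_left _ _).trans hi, ?_⟩
    ext p
    simp [gen]

theorem Generated.sep_unique {S : Set (ZigzagPoint N)} (hS : Generated S) {r s : Fin 3}
    (hr : sep r ∈ S) (hs : sep s ∈ S) : r = s := by
  obtain ⟨i, hi, rfl⟩ := hS.eq_gen hr
  exact (sep_mem_gen hi).1 hs

theorem link_mem_gen {r s : Fin 3} {i : Fin (N + 1)} {k : ℕ} :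
    link r i ∈ gen N s k ↔ (if s = r then (i : ℕ) + 1 else i) ≤ k := Iff.rfl

theorem gen_inter_gen_subset_succ (r : Fin 3) {i : ℕ} (hi : i < N) :
    gen N (r + 1) i ∩ gen N (r + 2) i ⊆ gen N r (i + 1) := by
  rintro (⟨q, m⟩ | q) ⟨h₁, h₂⟩
  · rw [link_mem_gen] at *
    split_ifs at * <;> omega
  · have h₁' := (sep_mem_gen hi.le).1 h₁
    have h₂' := (sep_mem_gen hi.le).1 h₂
    omega

theorem gen_inter_gen_succ_subset (r : Fin 3) {i : ℕ} (hi : i < N) :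
    gen N r i ∩ gen N (r + 1) (i + 1) ⊆ gen N (r + 2) (i + 1) := by
  rintro (⟨q, m⟩ | q) ⟨h₁, h₂⟩
  · rw [link_mem_gen] at *
    split_ifs at * <;> omega
  · have h₁' := (sep_mem_gen hi.le).1 h₁
    have h₂' := (sep_mem_gen (Nat.succ_le_of_lt hi)).1 h₂
    omega

theorem gen_injective (r : Fin 3) : Function.Injective fun i : Fin (N + 1) => gen N r i := by
  have key : ∀ i j : Fin (N + 1), gen N r i = gen N r j → j ≤ i := by
    intro i j h
    by_contra! hij
    have h₁ : link r i ∈ gen N r j := by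
      rw [link_mem_gen, if_pos rfl]
      exact hij
    rw [← h, link_mem_gen, if_pos rfl] at h₁
    omega
  exact fun i j h => le_antisymm (key j i h.symm) (key i j h)

end ZigzagPoint

open ZigzagPoint in
/-- The semilattice of generated sets, with intersection as its meet. -/
abbrev Zigzag (N : ℕ) : Type := {S : Set (ZigzagPoint N) // Generated S}

namespace Zigzag

open ZigzagPoint

variable {N : ℕ}

/-- The meet of the semilattice of generated sets. -/
def meet (x y : Zigzag N) : Zigzag N := ⟨x.1 ∩ y.1, x.2.inter y.2⟩

/-- The `i`-th generating set of the `r`-th chain as an element of the semilattice. -/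
def of (r : Fin 3) (i : ℕ) (hi : i ≤ N) : Zigzag N := ⟨gen N r i, .basic r i hi⟩

/-- The three atoms of `Z4`. -/
def atom : Fin 3 → Z4 := ![.a, .b, .c]

open scoped Classical in
/-- The projection to `Z4` which sends the `r`-th chain to the `r`-th atom. -/
noncomputable def proj (x : Zigzag N) : Z4 :=
  if sep 0 ∈ x.1 then .a else if sep 1 ∈ x.1 then .b else if sep 2 ∈ x.1 then .c else .zero

theorem proj_eq_atom {x : Zigzag N} {r : Fin 3} : proj x = atom r ↔ sep r ∈ x.1 := by
  have h₀₁ := fun h h' => x.2.sep_unique (r := 0) (s := 1) h h'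
  have h₀₂ := fun h h' => x.2.sep_unique (r := 0) (s := 2) h h'
  have h₁₂ := fun h h' => x.2.sep_unique (r := 1) (s := 2) h h'
  unfold proj
  fin_cases r <;> simp [atom] at * <;> split_ifs <;> simp_all

theorem proj_meet (x y : Zigzag N) : proj (meet x y) = z4meet (proj x) (proj y) := by
  have eq_of_atoms : ∀ u v : Z4, (∀ r, u = atom r ↔ v = atom r) → u = v := by
    intro u v h
    have h₀ := h 0
    have h₁ := h 1
    have h₂ := h 2
    cases u <;> cases v <;> simp_all [atom]
  have meet_atom : ∀ (u v : Z4) (r : Fin 3),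
      z4meet u v = atom r ↔ u = atom r ∧ v = atom r := by
    intro u v r
    cases u <;> cases v <;> fin_cases r <;> simp [z4meet, atom]
  refine eq_of_atoms _ _ fun r => ?_
  rw [meet_atom, proj_eq_atom, proj_eq_atom, proj_eq_atom]
  rfl

theorem proj_surjective : Function.Surjective (proj (N := N)) := by
  have h : ∀ r : Fin 3, proj (of (N := N) r 0 (Nat.zero_le _)) = atom r := fun r =>
    proj_eq_atom.2 ((sep_mem_gen (Nat.zero_le _)).2 rfl)
  rintro (_ | _ | _ | _)
  · refine ⟨meet (of 0 0 (Nat.zero_le _)) (of 1 0 (Nat.zero_le _)), ?_⟩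
    rw [proj_meet, h, h]
    rfl
  · exact ⟨_, h 0⟩
  · exact ⟨_, h 1⟩
  · exact ⟨_, h 2⟩

theorem map_mono {e : Zigzag N → Zigzag N} (he : ∀ x y, e (meet x y) = meet (e x) (e y))
    {x y : Zigzag N} (h : x.1 ⊆ y.1) : (e x).1 ⊆ (e y).1 := by
  have hxy : meet x y = x := Subtype.ext (Set.inter_eq_left.2 h)
  have := congrArg Subtype.val (he x y)
  rw [hxy] at this
  exact this.trans_subset Set.inter_subset_right

theorem map_inter_subset {e : Zigzag N → Zigzag N}
    (he : ∀ x y, e (meet x y) = meet (e x) (e y)) {x y z : Zigzag N} (h : x.1 ∩ y.1 ⊆ z.1) :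
    (e x).1 ∩ (e y).1 ⊆ (e z).1 := by
  have := map_mono he (x := meet x y) h
  rwa [he] at this

theorem exists_map_of_eq {e : Zigzag N → Zigzag N} (hproj : ∀ x, proj (e x) = proj x)
    (r : Fin 3) {i : ℕ} (hi : i ≤ N) : ∃ k ≤ N, (e (of r i hi)).1 = gen N r k := by
  refine (e (of r i hi)).2.eq_gen (proj_eq_atom.1 ?_)
  rw [hproj]
  exact proj_eq_atom.2 ((sep_mem_gen hi).2 rfl)

theorem subset_map_of {e : Zigzag N → Zigzag N}
    (he : ∀ x y, e (meet x y) = meet (e x) (e y)) (hproj : ∀ x, proj (e x) = proj x)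
    {i : ℕ} (hi : i ≤ N) (r : Fin 3) : gen N r i ⊆ (e (of r i hi)).1 := by
  induction i generalizing r with
  | zero =>
    obtain ⟨k, _, hk⟩ := exists_map_of_eq hproj r hi
    rw [hk]
    exact gen_mono r (Nat.zero_le k)
  | succ i ih =>
    have hi' : i ≤ N := by omega
    obtain ⟨k, _, hk⟩ := exists_map_of_eq hproj r hi
    have hlink : link r ⟨i, by omega⟩ ∈ (e (of r (i + 1) hi)).1 := by
      refine map_inter_subset he (x := of (r + 1) i hi') (y := of (r + 2) i hi')
        (z := of r (i + 1) hi) (gen_inter_gen_subset_succ r hi)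
        ⟨ih hi' _ ?_, ih hi' _ ?_⟩
      · rw [link_mem_gen, if_neg (by omega)]
      · rw [link_mem_gen, if_neg (by omega)]
    rw [hk, link_mem_gen, if_pos rfl] at hlink
    rw [hk]
    exact gen_mono r hlink

theorem map_of_subset {e : Zigzag N → Zigzag N}
    (he : ∀ x y, e (meet x y) = meet (e x) (e y)) (hproj : ∀ x, proj (e x) = proj x)
    {i : ℕ} (hi : i ≤ N) (r : Fin 3) : (e (of r i hi)).1 ⊆ gen N r i := by
  induction hi using Nat.decreasingInduction generalizing r with
  | self =>
    obtain ⟨k, hkN, hk⟩ := exists_map_of_eq hproj r le_rfl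
    rw [hk]
    exact gen_mono r hkN
  | of_succ i hi ih =>
    obtain ⟨k, hkN, hk⟩ := exists_map_of_eq hproj r hi.le
    rw [hk]
    refine gen_mono r ?_
    by_contra! hik
    have hlink : link (r + 2) ⟨i + 1, by omega⟩ ∈ gen N (r + 2) (i + 1) := by
      refine ih (r + 2) (map_inter_subset he (x := of r i hi.le) (y := of (r + 1) (i + 1) hi)
        (z := of (r + 2) (i + 1) hi) (gen_inter_gen_succ_subset r hi)
        ⟨?_, subset_map_of he hproj _ _ ?_⟩)
      · rw [hk, link_mem_gen, if_neg (by omega)]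
        exact hik
      · rw [link_mem_gen, if_neg (by omega)]
    rw [link_mem_gen, if_pos rfl] at hlink
    simp at hlink

theorem map_eq_self {e : Zigzag N → Zigzag N}
    (he : ∀ x y, e (meet x y) = meet (e x) (e y)) (hproj : ∀ x, proj (e x) = proj x)
    (x : Zigzag N) : e x = x := by
  obtain ⟨S, hS⟩ := x
  induction hS with
  | basic r i hi =>
    exact Subtype.ext
      ((map_of_subset he hproj hi r).antisymm (subset_map_of he hproj hi r))
  | inter hS hT ihS ihT =>
    have := he ⟨_, hS⟩ ⟨_, hT⟩
    rwa [ihS, ihT] at this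

theorem lt_natCard (N : ℕ) : N < Nat.card (Zigzag N) := by
  have h : Function.Injective fun i : Fin (N + 1) => of (N := N) 0 i (Nat.le_of_lt_succ i.2) :=
    fun i j hij => gen_injective 0 (congrArg Subtype.val hij)
  simpa using Nat.card_le_card_of_injective _ h

end Zigzag

/-- For every natural number `n` there is a finite meet-semilattice `X`
(a set with an associative, commutative, idempotent binary meet) with
`|X| > n` and a surjective meet-semilattice homomorphism `f : X → Z` such
that the identity is the only homomorphism `e : X → X` with `e ∘ e = e` and
`f ∘ e = f`; i.e. `X` is an `f`-core.  (So semilattices do not have bounded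
`f`-cores.) -/
theorem stmt9 :
    ∀ n : ℕ, ∃ (X : Type) (_ : Fintype X) (meet : X → X → X),
      (∀ x y z : X, meet (meet x y) z = meet x (meet y z)) ∧
      (∀ x y : X, meet x y = meet y x) ∧
      (∀ x : X, meet x x = x) ∧
      n < Fintype.card X ∧
      ∃ f : X → Z4, Function.Surjective f ∧
        (∀ x y, f (meet x y) = z4meet (f x) (f y)) ∧
        ∀ e : X → X,
          (∀ x y, e (meet x y) = meet (e x) (e y)) →
          (∀ x, e (e x) = e x) →
          (∀ x, f (e x) = f x) →
          ∀ x, e x = x := by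
  intro n
  refine ⟨Zigzag n, Fintype.ofFinite _, Zigzag.meet,
    fun _ _ _ => Subtype.ext (Set.inter_assoc _ _ _),
    fun _ _ => Subtype.ext (Set.inter_comm _ _), fun _ => Subtype.ext (Set.inter_self _), ?_,
    Zigzag.proj, Zigzag.proj_surjective, Zigzag.proj_meet,
    fun e he _ hproj => Zigzag.map_eq_self he hproj⟩
  rw [Fintype.card_eq_nat_card]
  exact Zigzag.lt_natCard n
end
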